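/- Let k, m, n be positive integers, let p_1, …, p_m ∈ [0,1] with p = max_j p_j > 0, and suppose n·∑_{j=1}^m p_j² = c with 0 < c < 1. Let (I_{i,j})_{1≤i≤k, 1≤j≤m} be mutually independent Bernoulli random variables where I_{i,j} equals 1 with probability p_j. Then P[ ∑_{i=1}^k ∑_{j=1}^m p_j·I_{i,j} > (1+c)·k/(2n) ] ≤ exp( −(1−c)²·k / (2·n·p·(4c+1)) ). -/

import Mathlib

open MeasureTheory

/-- The Bernoulli measure on `Bool` with success probability `p`. -/
noncomputable def bernoulliBool (p : ℝ) : Measure Bool :=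
  ENNReal.ofReal p • Measure.dirac true + ENNReal.ofReal (1 - p) • Measure.dirac false

instance (p : ℝ) : IsFiniteMeasure (bernoulliBool p) := by
  constructor
  simp only [bernoulliBool, Measure.coe_add, Measure.smul_apply, Pi.add_apply,
    smul_eq_mul, measure_univ, mul_one]
  exact ENNReal.add_lt_top.mpr ⟨ENNReal.ofReal_lt_top, ENNReal.ofReal_lt_top⟩

/-- Maximum of the attribute probabilities. -/
noncomputable def pmax {m : ℕ} (p : Fin m → ℝ) : ℝ := ⨆ j, p j

lemma integral_bernoulliBool {q : ℝ} (hq0 : 0 ≤ q) (hq1 : q ≤ 1) (f : Bool → ℝ) :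
    ∫ b, f b ∂bernoulliBool q = q * f true + (1 - q) * f false := by
  unfold bernoulliBool
  rw [integral_add_measure (.smul_measure .of_finite ENNReal.ofReal_ne_top)
    (.smul_measure .of_finite ENNReal.ofReal_ne_top)]
  simp [integral_smul_measure, ENNReal.toReal_ofReal hq0,
    ENNReal.toReal_ofReal (sub_nonneg.mpr hq1)]

/-- The chord bound for the exponential function on an interval `[0, b]`. -/
lemma exp_mul_sub_one_le_chord {a b l : ℝ} (ha : 0 ≤ a) (hb : 0 < b) (hab : a ≤ b) :
    Real.exp (l / b * a) - 1 ≤ a / b * (Real.exp l - 1) := by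
  have hle : a / b ≤ 1 := (div_le_one hb).mpr hab
  have h := convexOn_exp.2 (Set.mem_univ l) (Set.mem_univ (0 : ℝ))
    (div_nonneg ha hb.le) (sub_nonneg.mpr hle) (add_sub_cancel _ _)
  simp only [smul_eq_mul, mul_zero, add_zero, Real.exp_zero, mul_one] at h
  rw [show l / b * a = a / b * l by ring]
  linarith

/-- Moment generating function bound for a Bernoulli(`q`) indicator weighted by `q`. -/
lemma integral_exp_bernoulliBool_le {q b l : ℝ} (hq0 : 0 ≤ q) (hq1 : q ≤ 1) (hb : 0 < b)
    (hqb : q ≤ b) :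
    ∫ x, Real.exp (l / b * (q * if x = true then 1 else 0)) ∂bernoulliBool q ≤
      Real.exp (q ^ 2 * ((Real.exp l - 1) / b)) := by
  rw [integral_bernoulliBool hq0 hq1]
  simp only [if_true, mul_one, Bool.false_eq_true, if_false, mul_zero, Real.exp_zero]
  have h := mul_le_mul_of_nonneg_left (exp_mul_sub_one_le_chord (l := l) hq0 hb hqb) hq0
  have h' := Real.add_one_le_exp (q ^ 2 * ((Real.exp l - 1) / b))
  have e : q * (q / b * (Real.exp l - 1)) = q ^ 2 * ((Real.exp l - 1) / b) := by ring
  linarith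

/-- The Chernoff exponent for the optimal parameter `log ((1 + c) / (2 * c))`. -/
lemma chernoff_exponent_le {c : ℝ} (hc0 : 0 < c) (hc1 : c < 1) :
    c * ((1 + c) / (2 * c) - 1) - Real.log ((1 + c) / (2 * c)) * ((1 + c) / 2) ≤
      -((1 - c) ^ 2 / (2 * (4 * c + 1))) := by
  have hx : 0 ≤ (1 - c) / (2 * c) := div_nonneg (by linarith) (by linarith)
  have h := Real.le_log_one_add_of_nonneg hx
  have e1 : 1 + (1 - c) / (2 * c) = (1 + c) / (2 * c) := by field_simp; ring
  have e2 : 2 * ((1 - c) / (2 * c)) / ((1 - c) / (2 * c) + 2) = 2 * (1 - c) / (1 + 3 * c) := by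
    have : (1 - c) / (2 * c) + 2 = (1 + 3 * c) / (2 * c) := by field_simp; ring
    rw [this]
    field_simp
  rw [e1, e2] at h
  have h2 := mul_le_mul_of_nonneg_right h (show 0 ≤ (1 + c) / 2 by linarith)
  have e3 : c * ((1 + c) / (2 * c) - 1) = (1 - c) / 2 := by field_simp; ring
  have e4 : (1 - c) / 2 - 2 * (1 - c) / (1 + 3 * c) * ((1 + c) / 2) =
      -((1 - c) ^ 2 / (2 * (1 + 3 * c))) := by field_simp; ring
  have h3 : (1 - c) ^ 2 / (2 * (4 * c + 1)) ≤ (1 - c) ^ 2 / (2 * (1 + 3 * c)) := by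
    apply div_le_div_of_nonneg_left (sq_nonneg _) <;> linarith
  linarith

/-- concentration of the weight of discovered attributes: let
`I_{i,j}` (for `1 ≤ i ≤ k`, `1 ≤ j ≤ m`) be independent Bernoulli(`p_j`) indicators,
and suppose `n·∑ p_j² = c` with `0 < c < 1` and `p = max p_j > 0`. Then
`P[∑_{i,j} p_j·I_{i,j} > (1+c)·k/(2n)] ≤ exp(-(1-c)²·k/(2·n·p·(4c+1)))`. -/
theorem weight_upper_tail (k m n : ℕ) (hk : 0 < k) (hm : 0 < m) (hn : 0 < n)
    (p : Fin m → ℝ) (hp0 : ∀ j, 0 ≤ p j) (hp1 : ∀ j, p j ≤ 1)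
    (hpmax : 0 < pmax p)
    (c : ℝ) (hc0 : 0 < c) (hc1 : c < 1)
    (hc : (n : ℝ) * ∑ j, p j ^ 2 = c) :
    (Measure.pi fun ij : Fin k × Fin m => bernoulliBool (p ij.2))
      {ω | (1 + c) * k / (2 * n) <
        ∑ i : Fin k, ∑ j : Fin m, p j * (if ω (i, j) = true then 1 else 0)} ≤
      ENNReal.ofReal
        (Real.exp (-((1 - c) ^ 2 * k) / (2 * n * pmax p * (4 * c + 1)))) := by
  have hle : ∀ j, p j ≤ pmax p := fun j => le_ciSup (Set.finite_range p).bddAbove j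
  have hn' : (0 : ℝ) < n := Nat.cast_pos.mpr hn
  set b := pmax p
  set μ := Measure.pi fun ij : Fin k × Fin m => bernoulliBool (p ij.2)
  set l := Real.log ((1 + c) / (2 * c)) with hl
  have hy : 1 ≤ (1 + c) / (2 * c) := (one_le_div (by linarith)).mpr (by linarith)
  have hexp : Real.exp l = (1 + c) / (2 * c) := Real.exp_log (by linarith)
  have hl0 : 0 ≤ l := Real.log_nonneg hy
  let X : (Fin k × Fin m → Bool) → ℝ := fun ω =>
    ∑ i : Fin k, ∑ j : Fin m, p j * (if ω (i, j) = true then 1 else 0)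
  have hmgf : ProbabilityTheory.mgf X μ (l / b) ≤
      Real.exp (k * (∑ j, p j ^ 2) * ((Real.exp l - 1) / b)) := by
    have hprod : ∀ ω, Real.exp (l / b * X ω) = ∏ ij : Fin k × Fin m,
        Real.exp (l / b * (p ij.2 * if ω ij = true then 1 else 0)) := fun ω => by
      rw [← Real.exp_sum, Fintype.sum_prod_type]
      simp only [X, Finset.mul_sum]
    unfold ProbabilityTheory.mgf
    simp_rw [hprod]
    rw [integral_fintype_prod_eq_prod
      (fun (ij : Fin k × Fin m) (x : Bool) =>
        Real.exp (l / b * (p ij.2 * if x = true then 1 else 0)))]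
    refine (Finset.prod_le_prod (fun ij _ => integral_nonneg fun x => (Real.exp_pos _).le)
      fun ij _ => integral_exp_bernoulliBool_le (hp0 ij.2) (hp1 ij.2) hpmax (hle ij.2)).trans_eq ?_
    rw [← Real.exp_sum, Fintype.sum_prod_type]
    simp [← Finset.sum_mul, mul_assoc]
  have hchernoff := ProbabilityTheory.measure_ge_le_exp_mul_mgf (μ := μ) (X := X)
    ((1 + c) * k / (2 * n)) (div_nonneg hl0 hpmax.le) .of_finite
  have hsum : ∑ j, p j ^ 2 = c / n := by field_simp; linarith
  have hreal : μ.real {ω | (1 + c) * k / (2 * n) ≤ X ω} ≤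
      Real.exp (-((1 - c) ^ 2 * k) / (2 * n * b * (4 * c + 1))) := by
    refine hchernoff.trans ((mul_le_mul_of_nonneg_left hmgf (Real.exp_pos _).le).trans ?_)
    rw [← Real.exp_add, Real.exp_le_exp, hsum, hexp]
    have h := mul_le_mul_of_nonneg_left (chernoff_exponent_le hc0 hc1)
      (show 0 ≤ (k : ℝ) / (n * b) by positivity)
    rw [← hl] at h
    refine (le_of_eq ?_).trans (h.trans_eq ?_)
    · field_simp
      ring
    · have : 4 * c + 1 ≠ 0 := by positivity
      field_simp
  refine (measure_mono fun ω hω => ?_).trans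
    ((ENNReal.le_ofReal_iff_toReal_le (measure_ne_top _ _) (Real.exp_pos _).le).mpr hreal)
  exact le_of_lt (Set.mem_ofPred_eq ▸ hω)
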